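/- Let T be a tree and ω a nonnegative weight function on V(T). If every leaf of T has positive weight (L ⊆ W, where L is the set of degree-1 vertices and W = {v : ω(v) > 0}), then γ_ω(T) = max over v ∈ V(T) of Σ_{u ∈ V(T)} ω(u)·2^{d(u,v)}. -/

import Mathlib

open SimpleGraph Finset

variable {V : Type*} [DecidableEq V]

/-- A single pebbling move: remove two pebbles from `u` and add one on an adjacent `v`. -/
def PebStep (G : SimpleGraph V) (D D' : V → ℕ) : Prop :=
  ∃ u v, G.Adj u v ∧ 2 ≤ D u ∧
    D' = fun x => if x = u then D u - 2 else if x = v then D v + 1 else D x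

/-- Reachability by a sequence of pebbling moves. -/
def PebReach (G : SimpleGraph V) : (V → ℕ) → (V → ℕ) → Prop :=
  Relation.ReflTransGen (PebStep G)

/-- `D` is `ω`-solvable: some sequence of pebbling moves reaches `D'` with `D' ≥ ω`. -/
def Solvable (G : SimpleGraph V) (ω D : V → ℕ) : Prop :=
  ∃ D', PebReach G D D' ∧ ∀ v, ω v ≤ D' v

/-- The `ω`-cover pebbling number: least `N` such that every distribution of
`N` pebbles is `ω`-solvable. -/
noncomputable def coverNum [Fintype V] (G : SimpleGraph V) (ω : V → ℕ) : ℕ :=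
  sInf {N | ∀ D : V → ℕ, (∑ v, D v) = N → Solvable G ω D}

/-- The `t`-pebbling number of a vertex `v`: least `N` such that from every
distribution of `N` pebbles one can move `t` pebbles onto `v`. -/
noncomputable def ftNum [Fintype V] (G : SimpleGraph V) (v : V) (t : ℕ) : ℕ :=
  sInf {N | ∀ D : V → ℕ, (∑ x, D x) = N → ∃ D', PebReach G D D' ∧ t ≤ D' v}


set_option linter.unusedSectionVars false

section TreeMetric

variable {T : SimpleGraph V}

lemma tree_closer_neighbor_unique (hT : T.IsTree) {x u v w : V} (hv : T.Adj u v) (hw : T.Adj u w)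
    (hxv : T.dist x v < T.dist x u) (hxw : T.dist x w < T.dist x u) : v = w := by
  have key : ∀ z, T.Adj u z → T.dist x z < T.dist x u →
      ∃ p : T.Walk u x, p.IsPath ∧ p.snd = z := by
    intro z hz hlt
    obtain ⟨p, hp⟩ := hT.connected.exists_walk_length_eq_dist z x
    refine ⟨Walk.cons hz p, ?_, by simp⟩
    apply Walk.isPath_of_length_eq_dist
    have h1 := hT.dist_eq_dist_add_one_of_adj x hz
    rw [Walk.length_cons, hp, dist_comm (u := z), dist_comm (u := u)]
    omega
  obtain ⟨p, hp, rfl⟩ := key v hv hxv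
  obtain ⟨q, hq, rfl⟩ := key w hw hxw
  have := (hT.isAcyclic.subsingleton_path u x).elim ⟨p, hp⟩ ⟨q, hq⟩
  simp only [Subtype.mk.injEq] at this
  rw [this]

lemma tree_exists_closer_neighbor (hT : T.IsTree) {x u : V} (h : u ≠ x) :
    ∃ z, T.Adj u z ∧ T.dist x u = T.dist x z + 1 := by
  obtain ⟨p, hp⟩ := hT.connected.exists_walk_length_eq_dist u x
  cases p with
  | nil => exact absurd rfl h
  | @cons _ z _ hz p =>
    refine ⟨z, hz, ?_⟩
    have h1 := hT.dist_eq_dist_add_one_of_adj x hz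
    have h2 := dist_le p
    rw [Walk.length_cons] at hp
    rw [dist_comm (u := z)] at h2
    rw [dist_comm (u := u)] at hp
    omega

/-- Distances across an edge `uv` of a tree add up. -/
lemma tree_dist_across (hT : T.IsTree) {u v x : V} (huv : T.Adj u v)
    (hx : T.dist x u < T.dist x v) (y : V) (hy : T.dist y v < T.dist y u) :
    T.dist x y = T.dist x u + 1 + T.dist v y := by
  have hxv : T.dist x v = T.dist x u + 1 := by
    have := hT.dist_eq_dist_add_one_of_adj x huv
    omega
  rw [← hxv]
  induction hn : T.dist v y generalizing y with
  | zero =>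
    rw [hT.connected.dist_eq_zero_iff] at hn
    rw [hn]; simp
  | succ n ih =>
    have hne : y ≠ v := by rintro rfl; simp at hn
    obtain ⟨y', hyy', hd⟩ := tree_exists_closer_neighbor hT hne
    have e1 := hT.dist_eq_dist_add_one_of_adj u hyy'
    have e2 := hT.dist_eq_dist_add_one_of_adj y' huv
    have c1 := dist_comm (G := T) (u := y) (v := u)
    have c2 := dist_comm (G := T) (u := y) (v := v)
    have c3 := dist_comm (G := T) (u := y') (v := u)
    have c4 := dist_comm (G := T) (u := y') (v := v)
    have hy' := ih y' (by omega) (by omega)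
    rcases hT.dist_eq_dist_add_one_of_adj x hyy' with h | h
    · omega
    · exfalso
      by_cases hyv : y' = v
      · subst hyv
        have := tree_closer_neighbor_unique hT hyy'.symm huv.symm (x := x) (by omega) (by omega)
        subst this
        simp at hy
      · obtain ⟨z, hz, hzd⟩ := tree_exists_closer_neighbor hT hyv
        have tri := hT.connected.dist_triangle (u := x) (v := v) (w := z)
        have := tree_closer_neighbor_unique hT hyy'.symm hz (x := x) (by omega) (by omega)
        subst this
        omega

end TreeMetric

section Branch

variable [Fintype V] (T : SimpleGraph V)

/-- The vertices strictly closer to `u` than to `v`: for an edge `uv` of a tree,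
the component of `u` after deleting that edge. -/
noncomputable def branch (u v : V) : Finset V := univ.filter fun x => T.dist x u < T.dist x v

variable {T}

lemma mem_branch {u v x : V} : x ∈ branch T u v ↔ T.dist x u < T.dist x v := by
  simp [branch]

lemma not_mem_branch (hT : T.IsTree) {u v x : V} (h : T.Adj u v) :
    x ∉ branch T u v ↔ x ∈ branch T v u := by
  have := hT.dist_ne_of_adj x h
  rw [mem_branch, mem_branch]
  omega

lemma self_mem_branch {u v : V} (h : T.Adj u v) : u ∈ branch T u v := by
  rw [mem_branch, dist_eq_one_iff_adj.2 h]; simp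

lemma dist_of_mem_branch (hT : T.IsTree) {u v x : V} (h : T.Adj u v) (hx : x ∈ branch T u v) :
    T.dist x v = T.dist x u + 1 := by
  have := hT.dist_eq_dist_add_one_of_adj x h
  rw [mem_branch] at hx
  omega

lemma dist_across_branch (hT : T.IsTree) {u v x y : V} (h : T.Adj u v)
    (hx : x ∈ branch T u v) (hy : y ∈ branch T v u) :
    T.dist x y = T.dist x u + 1 + T.dist v y :=
  tree_dist_across hT h (mem_branch.1 hx) y (mem_branch.1 hy)

lemma branch_ne (hT : T.IsTree) {u w x : V} (h : T.Adj w u) (hx : x ∈ branch T w u) : x ≠ u := by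
  rintro rfl
  have := dist_of_mem_branch hT h hx
  simp at this

/-- A vertex other than `u` lies in a branch at a neighbour of `u`. -/
lemma exists_branch (hT : T.IsTree) {u x : V} (hx : x ≠ u) :
    ∃ w, T.Adj u w ∧ x ∈ branch T w u := by
  obtain ⟨w, hw, h⟩ := tree_exists_closer_neighbor hT hx.symm
  exact ⟨w, hw, mem_branch.2 (by omega)⟩

lemma branch_unique (hT : T.IsTree) {u w w' x : V} (hw : T.Adj u w) (hw' : T.Adj u w')
    (h : x ∈ branch T w u) (h' : x ∈ branch T w' u) : w = w' :=
  tree_closer_neighbor_unique hT hw hw' (mem_branch.1 h) (mem_branch.1 h')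

lemma branch_disjoint (hT : T.IsTree) {u w w' : V} (hw : T.Adj u w) (hw' : T.Adj u w')
    (hne : w ≠ w') : Disjoint (branch T w u) (branch T w' u) :=
  Finset.disjoint_left.2 fun _ h h' => hne (branch_unique hT hw hw' h h')

lemma branch_subset (hT : T.IsTree) {u v w : V} (huv : T.Adj u v) (hw : T.Adj u w) (hne : w ≠ v) :
    branch T w u ⊆ branch T u v := by
  intro x hx
  by_contra hc
  rw [not_mem_branch hT huv] at hc
  exact hne (branch_unique hT hw huv hx hc)

lemma branch_card_lt (hT : T.IsTree) {u v w : V} (huv : T.Adj u v) (hw : T.Adj u w)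
    (hne : w ≠ v) : (branch T w u).card < (branch T u v).card := by
  apply Finset.card_lt_card
  refine Finset.ssubset_iff_subset_ne.2 ⟨branch_subset hT huv hw hne, fun h => ?_⟩
  have := self_mem_branch huv
  rw [← h] at this
  exact branch_ne hT hw.symm this rfl

/-- Branches of a tree are geodesically convex. -/
lemma branch_convex (hT : T.IsTree) {u v a c x : V} (h : T.Adj u v) (ha : a ∈ branch T u v)
    (hc : c ∈ branch T u v) (hx : T.dist a x + T.dist x c = T.dist a c) : x ∈ branch T u v := by
  by_contra hn
  rw [not_mem_branch hT h] at hn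
  have h1 := dist_across_branch hT h ha hn
  have h2 := dist_across_branch hT h hc hn
  have h3 := hT.connected.dist_triangle (u := a) (v := u) (w := c)
  rw [dist_comm (u := c) (v := x)] at h2
  rw [dist_comm (u := u) (v := c)] at h3
  omega

end Branch

section Solvable

variable {G : SimpleGraph V}

lemma PebStep.add_right {D D' : V → ℕ} (h : PebStep G D D') (E : V → ℕ) :
    PebStep G (D + E) (D' + E) := by
  obtain ⟨u, v, huv, h2, rfl⟩ := h
  refine ⟨u, v, huv, ?_, ?_⟩
  · simp only [Pi.add_apply]; omega
  · funext x
    simp only [Pi.add_apply]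
    split_ifs with h1 h3
    · subst h1; omega
    · subst h3; omega
    · rfl

lemma PebReach.add_right {D D' : V → ℕ} (h : PebReach G D D') (E : V → ℕ) :
    PebReach G (D + E) (D' + E) := by
  induction h with
  | refl => exact Relation.ReflTransGen.refl
  | tail _ hs ih => exact ih.tail (hs.add_right E)

lemma solvable_of_le {ω D : V → ℕ} (h : ω ≤ D) : Solvable G ω D :=
  ⟨D, Relation.ReflTransGen.refl, h⟩

lemma Solvable.trans {A B C : V → ℕ} (h₁ : Solvable G B A) (h₂ : Solvable G C B) :
    Solvable G C A := by
  obtain ⟨A', hA, hBA⟩ := h₁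
  obtain ⟨B', hB, hCB⟩ := h₂
  obtain ⟨E, rfl⟩ : ∃ E, A' = B + E := ⟨A' - B, by
    funext x
    have := hBA x
    simp only [Pi.add_apply, Pi.sub_apply]
    omega⟩
  refine ⟨B' + E, Relation.ReflTransGen.trans hA (PebReach.add_right hB E), fun x => ?_⟩
  exact (hCB x).trans (Nat.le_add_right _ _)

lemma Solvable.add_right {A B : V → ℕ} (h : Solvable G B A) (E : V → ℕ) :
    Solvable G (B + E) (A + E) := by
  obtain ⟨A', hA, hBA⟩ := h
  exact ⟨A' + E, PebReach.add_right hA E, fun x => Nat.add_le_add_right (hBA x) _⟩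

lemma Solvable.add {A B A' B' : V → ℕ} (h : Solvable G B A) (h' : Solvable G B' A') :
    Solvable G (B + B') (A + A') := by
  refine (h.add_right A').trans ?_
  rw [add_comm B, add_comm B]
  exact h'.add_right B

lemma Solvable.sum {ι : Type*} (s : Finset ι) {A B : ι → V → ℕ}
    (h : ∀ i ∈ s, Solvable G (B i) (A i)) : Solvable G (∑ i ∈ s, B i) (∑ i ∈ s, A i) := by
  classical
  induction s using Finset.induction_on with
  | empty => exact solvable_of_le le_rfl
  | insert i s hi ih =>
    rw [Finset.sum_insert hi, Finset.sum_insert hi]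
    exact (h i (by simp)).add (ih fun j hj => h j (by simp [hj]))

lemma solvable_single_move {u v : V} (h : G.Adj u v) (k : ℕ) :
    Solvable G (Pi.single v k) (Pi.single u (2 * k)) := by
  induction k with
  | zero => exact solvable_of_le (by simp)
  | succ k ih =>
    have h1 : Solvable G (Pi.single v 1) (Pi.single u 2) := by
      refine ⟨_, Relation.ReflTransGen.single ⟨u, v, h, by simp, rfl⟩, fun x => ?_⟩
      have := h.ne
      by_cases hx : x = v
      · subst hx; simp [h.ne']
      · simp [hx]
    have := ih.add h1
    rwa [← Pi.single_add, ← Pi.single_add, show 2 * k + 2 = 2 * (k + 1) by ring] at this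

end Solvable

section Surplus

/-- What a branch with surplus `a` contributes to the vertex adjacent to it: half of the surplus if
it is nonnegative, and twice the (negative) deficit otherwise. -/
def transfer (a : ℤ) : ℤ := if 0 ≤ a then a / 2 else 2 * a

lemma transfer_mono {a b : ℤ} (h : a ≤ b) : transfer a ≤ transfer b := by
  unfold transfer; split_ifs <;> omega

lemma transfer_nonneg {a : ℤ} (h : 0 ≤ a) : 0 ≤ transfer a := by
  unfold transfer; split_ifs; omega

@[simp] lemma transfer_zero : transfer 0 = 0 := by simp [transfer]

variable [Fintype V] (T : SimpleGraph V) [DecidableRel T.Adj]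

/-- The recursion for `surplus`, cut off at depth `k`. -/
def surplusAux (h : V → ℤ) : ℕ → V → V → ℤ
  | 0, _, _ => 0
  | k + 1, u, v => h u + ∑ w ∈ (T.neighborFinset u).erase v, transfer (surplusAux h k w u)

/-- The number of pebbles (possibly negative) which the branch at `u` away from its neighbour `v`
can spare at `u`, where `h` is the number of pebbles minus the demand. -/
def surplus (h : V → ℤ) (u v : V) : ℤ := surplusAux T h (Fintype.card V) u v

/-- The number of pebbles (possibly negative) which the whole tree can spare at `r`. -/
def rootSurplus (h : V → ℤ) (r : V) : ℤ :=
  h r + ∑ w ∈ T.neighborFinset r, transfer (surplus T h w r)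

variable {T}

lemma surplusAux_succ (hT : T.IsTree) (h : V → ℤ) (k : ℕ) {u v : V} (huv : T.Adj u v)
    (hk : (branch T u v).card ≤ k) : surplusAux T h (k + 1) u v = surplusAux T h k u v := by
  induction k generalizing u v with
  | zero =>
    have := Finset.card_pos.2 ⟨u, self_mem_branch huv⟩
    omega
  | succ k ih =>
    rw [surplusAux, surplusAux]
    congr 1
    refine Finset.sum_congr rfl fun w hw => ?_
    simp only [Finset.mem_erase, mem_neighborFinset] at hw
    rw [ih hw.2.symm]
    have := branch_card_lt hT huv hw.2 hw.1
    omega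

lemma surplus_eq (hT : T.IsTree) (h : V → ℤ) {u v : V} (huv : T.Adj u v) :
    surplus T h u v = h u + ∑ w ∈ (T.neighborFinset u).erase v, transfer (surplus T h w u) := by
  rw [surplus, ← surplusAux_succ hT h _ huv (Finset.card_le_univ _), surplusAux]
  rfl

lemma rootSurplus_eq (hT : T.IsTree) (h : V → ℤ) {u v : V} (huv : T.Adj u v) :
    rootSurplus T h u = surplus T h u v + transfer (surplus T h v u) := by
  rw [surplus_eq hT h huv, rootSurplus, ← Finset.sum_erase_add _ _ ((mem_neighborFinset _ _ _).2 huv)]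
  ring

/-- Induction along the branches of a tree. -/
lemma branch_induction (hT : T.IsTree) {P : V → V → Prop}
    (step : ∀ u v, T.Adj u v → (∀ w, T.Adj u w → w ≠ v → P w u) → P u v)
    {u v : V} (huv : T.Adj u v) : P u v := by
  induction hn : (branch T u v).card using Nat.strong_induction_on generalizing u v with
  | _ n ih =>
    subst hn
    exact step u v huv fun w hw hne => ih _ (branch_card_lt hT huv hw hne) hw.symm rfl

lemma surplus_mono (hT : T.IsTree) {h h' : V → ℤ} {u v : V} (huv : T.Adj u v)
    (hh : ∀ x ∈ branch T u v, h x ≤ h' x) : surplus T h u v ≤ surplus T h' u v := by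
  revert hh
  refine branch_induction hT (P := fun u v => (∀ x ∈ branch T u v, h x ≤ h' x) →
    surplus T h u v ≤ surplus T h' u v) ?_ huv
  intro u v huv ih hh
  rw [surplus_eq hT h huv, surplus_eq hT h' huv]
  refine add_le_add (hh u (self_mem_branch huv)) (Finset.sum_le_sum fun w hw => ?_)
  simp only [Finset.mem_erase, mem_neighborFinset] at hw
  exact transfer_mono (ih w hw.2 hw.1 fun x hx => hh x (branch_subset hT huv hw.2 hw.1 hx))

lemma surplus_congr (hT : T.IsTree) {h h' : V → ℤ} {u v : V} (huv : T.Adj u v)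
    (hh : ∀ x ∈ branch T u v, h x = h' x) : surplus T h u v = surplus T h' u v :=
  le_antisymm (surplus_mono hT huv fun x hx => (hh x hx).le)
    (surplus_mono hT huv fun x hx => (hh x hx).ge)

lemma surplus_zero (hT : T.IsTree) {u v : V} (huv : T.Adj u v) :
    surplus T (fun _ => 0) u v = 0 := by
  refine branch_induction hT (P := fun u v => surplus T (fun _ => 0) u v = 0) ?_ huv
  intro u v huv ih
  rw [surplus_eq hT _ huv, zero_add]
  refine Finset.sum_eq_zero fun w hw => ?_
  simp only [Finset.mem_erase, mem_neighborFinset] at hw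
  rw [ih w hw.2 hw.1, transfer_zero]

lemma surplus_nonneg (hT : T.IsTree) {h : V → ℤ} {u v : V} (huv : T.Adj u v)
    (hh : ∀ x ∈ branch T u v, 0 ≤ h x) : 0 ≤ surplus T h u v :=
  (surplus_zero hT huv).ge.trans (surplus_mono hT huv hh)

lemma rootSurplus_mono (hT : T.IsTree) {h h' : V → ℤ} (hh : ∀ x, h x ≤ h' x) (r : V) :
    rootSurplus T h r ≤ rootSurplus T h' r := by
  refine add_le_add (hh r) (Finset.sum_le_sum fun w hw => transfer_mono ?_)
  rw [mem_neighborFinset] at hw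
  exact surplus_mono hT hw.symm fun x _ => hh x

/-- The sign of the surplus does not depend on the root. -/
lemma rootSurplus_neg (hT : T.IsTree) {h : V → ℤ} {r : V} (hr : rootSurplus T h r < 0) (x : V) :
    rootSurplus T h x < 0 := by
  obtain ⟨p⟩ := hT.connected r x
  induction p with
  | nil => exact hr
  | @cons u v _ huv p ih =>
    apply ih
    rw [rootSurplus_eq hT h huv] at hr
    rw [rootSurplus_eq hT h huv.symm]
    generalize surplus T h u v = a at *
    generalize surplus T h v u = b at *
    unfold transfer at *
    split_ifs at * <;> omega

/-- If no edge separates the tree into two deficient branches, some vertex has no deficient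
branch. -/
lemma exists_sink (hT : T.IsTree) {h : V → ℤ}
    (hh : ∀ u v, T.Adj u v → surplus T h u v < 0 → 0 ≤ surplus T h v u) :
    ∃ r, ∀ w, T.Adj r w → 0 ≤ surplus T h w r := by
  by_contra! hc
  have key : ∀ u v, T.Adj u v → 0 ≤ surplus T h u v := by
    intro u v huv
    refine branch_induction hT (P := fun u v => 0 ≤ surplus T h u v) ?_ huv
    intro u v huv ih
    by_contra! hneg
    obtain ⟨w, hw, hlt⟩ := hc u
    have hne : w ≠ v := by
      rintro rfl
      exact absurd (hh u w huv hneg) hlt.not_ge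
    exact absurd (ih w hw hne) hlt.not_ge
  obtain ⟨r⟩ := hT.connected.nonempty
  obtain ⟨w, hw, hlt⟩ := hc r
  exact absurd (key w r hw.symm) hlt.not_ge

end Surplus

section Decomposition

variable [Fintype V] {T : SimpleGraph V} [DecidableRel T.Adj]

lemma sum_eq_sum_branches (hT : T.IsTree) {M : Type*} [AddCommMonoid M] (F : V → M) (r : V) :
    ∑ x, F x = F r + ∑ w ∈ T.neighborFinset r, ∑ x ∈ branch T w r, F x := by
  rw [← Finset.sum_biUnion, ← Finset.sum_insert]
  · refine Finset.sum_congr (Finset.eq_univ_iff_forall.2 fun x => ?_).symm fun _ _ => rfl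
    by_cases hx : x = r
    · simp [hx]
    · obtain ⟨w, hw, hxw⟩ := exists_branch hT hx
      simp only [Finset.mem_insert, Finset.mem_biUnion, mem_neighborFinset]
      exact Or.inr ⟨w, hw, hxw⟩
  · simp only [Finset.mem_biUnion, mem_neighborFinset, not_exists, not_and]
    exact fun w hw hr => branch_ne hT hw.symm hr rfl
  · intro w hw w' hw' hne
    simp only [Finset.mem_coe, mem_neighborFinset] at hw hw'
    exact branch_disjoint hT hw hw' hne

lemma sum_branch_eq (hT : T.IsTree) {M : Type*} [AddCommMonoid M] (F : V → M) {u v : V}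
    (huv : T.Adj u v) : ∑ x ∈ branch T u v, F x =
      F u + ∑ w ∈ (T.neighborFinset u).erase v, ∑ x ∈ branch T w u, F x := by
  have hsum := sum_eq_sum_branches hT (fun x => if x ∈ branch T u v then F x else 0) u
  rw [← Finset.sum_filter, Finset.filter_mem_eq_inter, Finset.univ_inter,
    if_pos (self_mem_branch huv),
    ← Finset.add_sum_erase _ _ ((mem_neighborFinset _ _ _).2 huv)] at hsum
  rw [hsum, Finset.sum_eq_zero (s := branch T v u), zero_add]
  · congr 1
    refine Finset.sum_congr rfl fun w hw => Finset.sum_congr rfl fun x hx => ?_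
    simp only [Finset.mem_erase, mem_neighborFinset] at hw
    rw [if_pos (branch_subset hT huv hw.2 hw.1 hx)]
  · intro x hx
    rw [if_neg ((not_mem_branch hT huv).2 hx)]

/-- The distribution `D` restricted to `B`. -/
def restrictTo (D : V → ℕ) (B : Finset V) : V → ℕ := ∑ x ∈ B, Pi.single x (D x)

/-- Solutions of the branches at `u` combine to a solution of their union with `u`. -/
lemma solvable_star {ω D : V → ℕ} {u : V} {g : V → ℤ} {A : Finset V}
    (hA : ∀ w ∈ A, T.Adj u w)
    (hs : ∀ w ∈ A, Solvable T (restrictTo ω (branch T w u) + Pi.single w (g w).toNat)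
      (restrictTo D (branch T w u) + Pi.single w (-g w).toNat))
    {a b : ℕ} (hab : (a : ℤ) + ∑ w ∈ A, transfer (g w) = b) :
    Solvable T (Pi.single u b + ∑ w ∈ A, restrictTo ω (branch T w u))
      (Pi.single u a + ∑ w ∈ A, restrictTo D (branch T w u)) := by
  set mid : V → V → ℕ := fun w =>
    if 0 ≤ g w then restrictTo ω (branch T w u) else restrictTo D (branch T w u) with hmid
  have hgain : ∀ w ∈ A, Solvable T (mid w + Pi.single u (transfer (g w)).toNat)
      (restrictTo D (branch T w u)) := by
    intro w hw
    have h := hs w hw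
    simp only [hmid, transfer]
    split_ifs with hg
    · rw [show (-g w).toNat = 0 by omega, Pi.single_zero, add_zero] at h
      refine Solvable.trans h ((solvable_of_le ?_).trans
        (Solvable.add (solvable_of_le le_rfl) (solvable_single_move (hA w hw).symm _)))
      refine add_le_add le_rfl (Pi.single_mono _ ?_)
      omega
    · rw [show (2 * g w).toNat = 0 by omega, Pi.single_zero, add_zero]
      exact solvable_of_le le_rfl
  have hpay : ∀ w ∈ A, Solvable T (restrictTo ω (branch T w u))
      (mid w + Pi.single u (-transfer (g w)).toNat) := by
    intro w hw
    have h := hs w hw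
    simp only [hmid, transfer]
    split_ifs with hg
    · exact solvable_of_le (le_add_of_nonneg_right zero_le)
    · rw [show (g w).toNat = 0 by omega, Pi.single_zero, add_zero] at h
      refine Solvable.trans ?_ h
      rw [show (-(2 * g w)).toNat = 2 * (-g w).toNat by omega]
      exact Solvable.add (solvable_of_le le_rfl) (solvable_single_move (hA w hw) _)
  have h1 := (solvable_of_le (G := T) (le_refl (Pi.single u a))).add (Solvable.sum A hgain)
  have h2 := (solvable_of_le (G := T) (le_refl (Pi.single u b))).add (Solvable.sum A hpay)
  refine h1.trans ((solvable_of_le (le_of_eq ?_)).trans h2)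
  have hsingle : ∀ k : V → ℕ,
      ∑ w ∈ A, (Pi.single u (k w) : V → ℕ) = Pi.single u (∑ w ∈ A, k w) := fun k =>
    (map_sum (AddMonoidHom.single (fun _ : V => ℕ) u) k A).symm
  rw [Finset.sum_add_distrib, Finset.sum_add_distrib, hsingle, hsingle,
    add_left_comm (Pi.single u a : V → ℕ), add_left_comm (Pi.single u b : V → ℕ),
    ← Pi.single_add, ← Pi.single_add]
  congr 2
  zify
  rw [← hab, add_assoc, ← Finset.sum_add_distrib]
  congr 1
  refine Finset.sum_congr rfl fun w _ => ?_
  omega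

lemma solvable_branch (hT : T.IsTree) {ω D : V → ℕ} {u v : V} (huv : T.Adj u v) :
    Solvable T
      (restrictTo ω (branch T u v) +
        Pi.single u (surplus T (fun x => (D x : ℤ) - ω x) u v).toNat)
      (restrictTo D (branch T u v) +
        Pi.single u (-surplus T (fun x => (D x : ℤ) - ω x) u v).toNat) := by
  refine branch_induction hT (P := fun u v => Solvable T
      (restrictTo ω (branch T u v) +
        Pi.single u (surplus T (fun x => (D x : ℤ) - ω x) u v).toNat)
      (restrictTo D (branch T u v) +
        Pi.single u (-surplus T (fun x => (D x : ℤ) - ω x) u v).toNat)) ?_ huv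
  intro u v huv ih
  set g := surplus T (fun x => (D x : ℤ) - ω x) with hg
  have hstar := solvable_star (T := T) (ω := ω) (D := D) (u := u) (g := fun w => g w u)
    (A := (T.neighborFinset u).erase v) (a := D u + (-g u v).toNat) (b := ω u + (g u v).toNat)
    (fun w hw => by simpa using (Finset.mem_erase.1 hw).2)
    (fun w hw => by
      simp only [Finset.mem_erase, mem_neighborFinset] at hw
      exact ih w hw.2 hw.1)
    (by
      have := surplus_eq hT (fun x => (D x : ℤ) - ω x) huv
      rw [← hg] at this
      push_cast
      omega)
  have hdec : ∀ E : V → ℕ, ∀ k, Pi.single u (E u + k) +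
      ∑ w ∈ (T.neighborFinset u).erase v, restrictTo E (branch T w u) =
      restrictTo E (branch T u v) + Pi.single u k := by
    intro E k
    simp only [restrictTo]
    rw [sum_branch_eq hT _ huv, Pi.single_add]
    abel
  rwa [hdec, hdec] at hstar

lemma solvable_of_rootSurplus_nonneg (hT : T.IsTree) {ω D : V → ℕ} {r : V}
    (h : 0 ≤ rootSurplus T (fun x => (D x : ℤ) - ω x) r) : Solvable T ω D := by
  have hstar := solvable_star (T := T) (ω := ω) (D := D) (u := r)
    (g := fun w => surplus T (fun x => (D x : ℤ) - ω x) w r)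
    (A := T.neighborFinset r) (a := D r)
    (b := ω r + (rootSurplus T (fun x => (D x : ℤ) - ω x) r).toNat)
    (fun w hw => by simpa using hw)
    (fun w hw => solvable_branch hT ((mem_neighborFinset _ _ _).1 hw).symm)
    (by
      push_cast
      rw [Int.toNat_of_nonneg h, rootSurplus]
      ring)
  have hdec : ∀ E : V → ℕ, Pi.single r (E r) +
      ∑ w ∈ T.neighborFinset r, restrictTo E (branch T w r) = E := by
    intro E
    simp only [restrictTo]
    rw [← sum_eq_sum_branches hT (fun x => (Pi.single x (E x) : V → ℕ)), Finset.univ_sum_single]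
  rw [Pi.single_add, add_right_comm, hdec, hdec] at hstar
  exact hstar.trans (solvable_of_le (le_add_of_nonneg_right zero_le))

end Decomposition

section StackingCost

variable [Fintype V] {T : SimpleGraph V} [DecidableRel T.Adj]

/-- Combining bounds for the branches at `r` into a bound for the whole tree. -/
lemma exists_stacking_of_branches (hT : T.IsTree) {ω D : V → ℕ} {r : V} {S : Finset V} (hrS : r ∈ S)
    (hr : rootSurplus T (fun x => (D x : ℤ) - ω x) r < 0)
    (hnn : ∀ w, T.Adj r w → 0 ≤ surplus T (fun x => (D x : ℤ) - ω x) w r)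
    (hb : ∀ w, T.Adj r w → (∃ x ∈ branch T w r, D x ≠ 0) →
      (∃ c ∈ branch T w r, ω c ≠ 0) ∧ ∃ v ∈ S, v ∈ branch T w r ∧
        ∑ x ∈ branch T w r, (D x : ℤ) < ∑ x ∈ branch T w r, (ω x : ℤ) * 2 ^ T.dist x v +
          (surplus T (fun x => (D x : ℤ) - ω x) w r + 1) * 2 ^ T.dist w v) :
    ∃ v ∈ S, ∑ x, (D x : ℤ) < ∑ x, (ω x : ℤ) * 2 ^ T.dist x v := by
  classical
  set p := fun w => surplus T (fun x => (D x : ℤ) - ω x) w r with hp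
  set f := fun w => transfer (p w) with hf
  have hfp : ∀ w, T.Adj r w → 0 ≤ f w ∧ p w ≤ 2 * f w + 1 := by
    intro w hw
    have := hnn w hw
    simp only [hf, transfer, hp]
    rw [if_pos this]
    omega
  have hroot : (D r : ℤ) + 1 + ∑ w ∈ T.neighborFinset r, f w ≤ ω r := by
    rw [rootSurplus] at hr
    linarith
  have hfsum : 0 ≤ ∑ w ∈ T.neighborFinset r, f w :=
    Finset.sum_nonneg fun w hw => (hfp w (by simpa using hw)).1
  set A := (T.neighborFinset r).filter fun w => ∃ x ∈ branch T w r, D x ≠ 0 with hA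
  have hinactive : ∀ w, w ∉ A → T.Adj r w → ∑ x ∈ branch T w r, (D x : ℤ) = 0 := by
    intro w hwA hw
    refine Finset.sum_eq_zero fun x hx => ?_
    by_contra hne
    exact hwA (by simp only [hA, Finset.mem_filter, mem_neighborFinset]
                  exact ⟨hw, x, hx, by exact_mod_cast hne⟩)
  rcases A.eq_empty_or_nonempty with hempty | hnonempty
  · refine ⟨r, hrS, ?_⟩
    rw [sum_eq_sum_branches hT _ r, Finset.sum_eq_zero]
    · have : (ω r : ℤ) * 2 ^ T.dist r r ≤ ∑ x, (ω x : ℤ) * 2 ^ T.dist x r :=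
        Finset.single_le_sum (f := fun x => (ω x : ℤ) * 2 ^ T.dist x r)
          (fun _ _ => by positivity) (Finset.mem_univ r)
      simp only [dist_self, pow_zero, mul_one] at this
      linarith
    · intro w hw
      exact hinactive w (by simp [hempty]) (by simpa using hw)
  have hAadj : ∀ w ∈ A, T.Adj r w := fun w hw => by simpa using (Finset.mem_filter.1 hw).1
  have hb' : ∀ w, ∃ v, w ∈ A → (v ∈ S ∧ v ∈ branch T w r ∧
        ∑ x ∈ branch T w r, (D x : ℤ) < ∑ x ∈ branch T w r, (ω x : ℤ) * 2 ^ T.dist x v +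
          (p w + 1) * 2 ^ T.dist w v) := by
    intro w
    by_cases hw : w ∈ A
    · obtain ⟨-, v, hv⟩ := hb w (hAadj w hw) (Finset.mem_filter.1 hw).2
      exact ⟨v, fun _ => hv⟩
    · exact ⟨r, fun h => absurd h hw⟩
  choose st hst using hb'
  obtain ⟨i, hiA, hmax⟩ := Finset.exists_max_image A (fun w => T.dist w (st w)) hnonempty
  have hri := hAadj i hiA
  obtain ⟨hvS, hvB, hvlt⟩ := hst i hiA
  set v := st i with hv
  set d := T.dist i v with hd
  have hrv : T.dist r v = d + 1 := by
    rw [dist_comm, dist_of_mem_branch hT hri.symm hvB, hd, dist_comm]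
  refine ⟨v, hvS, ?_⟩
  set L := fun w => ∑ x ∈ branch T w r, (ω x : ℤ) * 2 ^ T.dist x v + 2 ^ (d + 1) * f w with hL
  have hLi : ∑ x ∈ branch T i r, (D x : ℤ) + 1 ≤ L i + 2 ^ (d + 1) := by
    have h1 : (p i + 1) * 2 ^ d ≤ (2 * f i + 2) * 2 ^ d :=
      mul_le_mul_of_nonneg_right (by linarith [(hfp i hri).2]) (by positivity)
    simp only [hL, pow_succ]
    linarith
  have hLj : ∀ w ∈ (T.neighborFinset r).erase i, ∑ x ∈ branch T w r, (D x : ℤ) ≤ L w := by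
    intro w hw
    simp only [Finset.mem_erase, mem_neighborFinset] at hw
    have hf0 := hfp w hw.2
    by_cases hwA : w ∈ A
    · obtain ⟨⟨c, hc, hωc⟩, -⟩ := hb w hw.2 (Finset.mem_filter.1 hwA).2
      obtain ⟨-, hwB, hwlt⟩ := hst w hwA
      have hle : T.dist w (st w) ≤ d := hmax w hwA
      set C := ∑ x ∈ branch T w r, (ω x : ℤ) * 2 ^ T.dist x w with hC
      have hC1 : 1 ≤ C := by
        have h1 : (ω c : ℤ) * 2 ^ T.dist c w ≤ C :=
          Finset.single_le_sum (f := fun x => (ω x : ℤ) * 2 ^ T.dist x w)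
            (fun _ _ => by positivity) hc
        have h2 : (1 : ℤ) ≤ (ω c : ℤ) * 2 ^ T.dist c w := by
          have : 0 < ω c * 2 ^ T.dist c w := by positivity
          exact_mod_cast this
        linarith
      have hLw : L w = 2 ^ d * (4 * C + 2 * f w) := by
        have : ∑ x ∈ branch T w r, (ω x : ℤ) * 2 ^ T.dist x v = 2 ^ (d + 2) * C := by
          rw [hC, Finset.mul_sum]
          refine Finset.sum_congr rfl fun x hx => ?_
          have hvw : v ∈ branch T r w :=
            (not_mem_branch hT hw.2.symm).1 fun h => hw.1 (branch_unique hT hw.2 hri h hvB)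
          rw [dist_across_branch hT hw.2.symm hx hvw, hrv]
          ring
        simp only [hL]
        rw [this]
        ring
      have hstack : ∑ x ∈ branch T w r, (ω x : ℤ) * 2 ^ T.dist x (st w) ≤
          2 ^ T.dist w (st w) * C := by
        rw [hC, Finset.mul_sum]
        refine Finset.sum_le_sum fun x _ => ?_
        rw [mul_left_comm, ← pow_add]
        refine mul_le_mul_of_nonneg_left (pow_le_pow_right₀ (by norm_num) ?_) (by positivity)
        rw [add_comm]
        exact hT.connected.dist_triangle
      have hpow : (2 : ℤ) ^ T.dist w (st w) ≤ 2 ^ d := pow_le_pow_right₀ (by norm_num) hle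
      have hpw : 0 ≤ p w := hnn w hw.2
      calc ∑ x ∈ branch T w r, (D x : ℤ) ≤ 2 ^ T.dist w (st w) * (C + p w + 1) := by linarith
        _ ≤ 2 ^ d * (C + p w + 1) := mul_le_mul_of_nonneg_right hpow (by linarith)
        _ ≤ 2 ^ d * (4 * C + 2 * f w) := mul_le_mul_of_nonneg_left (by linarith) (by positivity)
        _ = L w := hLw.symm
    · rw [hinactive w hwA hw.2]
      exact add_nonneg (Finset.sum_nonneg fun _ _ => by positivity)
        (mul_nonneg (by positivity) hf0.1)
  have hiN : i ∈ T.neighborFinset r := by simpa using hri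
  have hsumL : ∑ w ∈ T.neighborFinset r, ∑ x ∈ branch T w r, (D x : ℤ) + 1 ≤
      ∑ w ∈ T.neighborFinset r, L w + 2 ^ (d + 1) := by
    rw [← Finset.sum_erase_add _ _ hiN, ← Finset.sum_erase_add _ L hiN]
    have := Finset.sum_le_sum hLj
    linarith
  rw [sum_eq_sum_branches hT _ r, sum_eq_sum_branches hT _ r, hrv]
  simp only [hL] at hsumL
  rw [Finset.sum_add_distrib, ← Finset.mul_sum] at hsumL
  have hlast : (D r : ℤ) ≤ 2 ^ (d + 1) * (ω r - 1 - ∑ w ∈ T.neighborFinset r, f w) := by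
    have h1 : (1 : ℤ) ≤ 2 ^ (d + 1) := one_le_pow₀ (by norm_num)
    have h2 : (D r : ℤ) ≤ ω r - 1 - ∑ w ∈ T.neighborFinset r, f w := by linarith
    have h3 : (0 : ℤ) ≤ D r := by positivity
    nlinarith
  linarith

end StackingCost

section StackingTheorem

variable [Fintype V] {T : SimpleGraph V} [DecidableRel T.Adj]

/-- Every vertex of the support of `D` lies between two vertices of the support of `ω`. -/
def SupportedInHull (T : SimpleGraph V) (ω D : V → ℕ) : Prop :=
  ∀ x, D x ≠ 0 → ∃ a c, ω a ≠ 0 ∧ ω c ≠ 0 ∧ T.dist a x + T.dist x c = T.dist a c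

lemma exists_demand_of_surplus_neg (hT : T.IsTree) {ω D : V → ℕ} {u v : V} (huv : T.Adj u v)
    (h : surplus T (fun x => (D x : ℤ) - ω x) u v < 0) : ∃ c ∈ branch T u v, ω c ≠ 0 := by
  by_contra! hc
  refine absurd (surplus_nonneg hT huv fun x hx => ?_) h.not_ge
  simp [hc x hx]

lemma SupportedInHull.exists_mem_branch (hT : T.IsTree) {ω D : V → ℕ} (hD : SupportedInHull T ω D)
    {u v : V} (huv : T.Adj u v) (h : ∃ x ∈ branch T u v, D x ≠ 0) :
    ∃ c ∈ branch T u v, ω c ≠ 0 := by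
  obtain ⟨x, hx, hDx⟩ := h
  obtain ⟨a, c, ha, hc, hac⟩ := hD x hDx
  by_contra! hn
  have ha' := (not_mem_branch hT huv).1 fun h => ha (hn a h)
  have hc' := (not_mem_branch hT huv).1 fun h => hc (hn c h)
  exact (not_mem_branch hT huv.symm).2 hx (branch_convex hT huv.symm ha' hc' hac)

/-- The demand in the branch at `w`, with `k` further pebbles demanded at `w`. -/
noncomputable def branchDemand (T : SimpleGraph V) (ω : V → ℕ) (w r : V) (k : ℕ) (x : V) : ℕ :=
  (if T.dist x w < T.dist x r then ω x else 0) + if x = w then k else 0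

/-- The pebbles in the branch at `w`. -/
noncomputable def branchPebbles (T : SimpleGraph V) (D : V → ℕ) (w r x : V) : ℕ :=
  if T.dist x w < T.dist x r then D x else 0

lemma SupportedInHull.restrict_branch (hT : T.IsTree) {ω D : V → ℕ} (hD : SupportedInHull T ω D)
    {w r : V} (hwr : T.Adj w r) (k : ℕ) :
    SupportedInHull T (branchDemand T ω w r (k + 1)) (branchPebbles T D w r) := by
  have hw : branchDemand T ω w r (k + 1) w ≠ 0 := by simp [branchDemand]
  have hin : ∀ a ∈ branch T w r, ω a ≠ 0 → branchDemand T ω w r (k + 1) a ≠ 0 := by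
    intro a ha hωa
    rw [mem_branch] at ha
    simp [branchDemand, ha, hωa]
  intro x hx
  have hxB : x ∈ branch T w r := by
    rw [mem_branch]
    by_contra hc
    simp [branchPebbles, hc] at hx
  have hDx : D x ≠ 0 := by
    rw [mem_branch] at hxB
    simpa [branchPebbles, hxB] using hx
  obtain ⟨a, c, ha, hc, hac⟩ := hD x hDx
  by_cases haB : a ∈ branch T w r
  · by_cases hcB : c ∈ branch T w r
    · exact ⟨a, c, hin a haB ha, hin c hcB hc, hac⟩
    · refine ⟨a, w, hin a haB ha, hw, ?_⟩
      rw [not_mem_branch hT hwr] at hcB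
      have h1 := dist_across_branch hT hwr haB hcB
      have h2 := dist_across_branch hT hwr hxB hcB
      omega
  · rw [not_mem_branch hT hwr] at haB
    by_cases hcB : c ∈ branch T w r
    · refine ⟨w, c, hw, hin c hcB hc, ?_⟩
      have h1 := dist_across_branch hT hwr.symm haB hcB
      have h2 := dist_across_branch hT hwr.symm haB hxB
      omega
    · rw [not_mem_branch hT hwr] at hcB
      exact absurd (branch_convex hT hwr.symm haB hcB hac)
        ((not_mem_branch hT hwr.symm).2 hxB)

lemma sum_branchDemand (ω : V → ℕ) (w r : V) (k : ℕ) (F : V → ℤ) :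
    ∑ x, (branchDemand T ω w r k x : ℤ) * F x =
      ∑ x ∈ branch T w r, (ω x : ℤ) * F x + k * F w := by
  simp only [branchDemand, branch, Nat.cast_add, add_mul, Finset.sum_add_distrib,
    Finset.sum_filter, Nat.cast_ite, Nat.cast_zero, ite_mul, zero_mul]
  simp

lemma sum_branchPebbles (D : V → ℕ) (w r : V) :
    ∑ x, (branchPebbles T D w r x : ℤ) = ∑ x ∈ branch T w r, (D x : ℤ) := by
  simp only [branchPebbles, branch, Finset.sum_filter, Nat.cast_ite, Nat.cast_zero]

lemma rootSurplus_branch_neg (hT : T.IsTree) {ω D : V → ℕ} {w r : V} (hwr : T.Adj w r)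
    (hs : 0 ≤ surplus T (fun x => (D x : ℤ) - ω x) w r) :
    rootSurplus T (fun x => (branchPebbles T D w r x : ℤ) - branchDemand T ω w r
      ((surplus T (fun x => (D x : ℤ) - ω x) w r).toNat + 1) x) w < 0 := by
  set k := (surplus T (fun x => (D x : ℤ) - ω x) w r).toNat with hk
  rw [rootSurplus_eq hT _ hwr, surplus_congr hT hwr.symm (h' := fun _ => 0), surplus_zero hT hwr.symm,
    transfer_zero, add_zero, surplus_eq hT _ hwr]
  · have hself : T.dist w w < T.dist w r := mem_branch.1 (self_mem_branch hwr)
    have hsum : ∑ z ∈ (T.neighborFinset w).erase r, transfer (surplus T (fun x =>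
        (branchPebbles T D w r x : ℤ) - branchDemand T ω w r (k + 1) x) z w) =
        ∑ z ∈ (T.neighborFinset w).erase r,
          transfer (surplus T (fun x => (D x : ℤ) - ω x) z w) := by
      refine Finset.sum_congr rfl fun z hz => ?_
      simp only [Finset.mem_erase, mem_neighborFinset] at hz
      congr 1
      refine surplus_congr hT hz.2.symm fun x hx => ?_
      have hxw := branch_ne hT hz.2.symm hx
      have hxB := mem_branch.1 (branch_subset hT hwr hz.2 hz.1 hx)
      simp [branchPebbles, branchDemand, hxw, hxB]
    have horig := surplus_eq hT (fun x => (D x : ℤ) - ω x) hwr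
    rw [hsum]
    simp only [branchPebbles, branchDemand, if_pos hself, if_true]
    push_cast
    omega
  · intro x hx
    have hxB : ¬ T.dist x w < T.dist x r := by
      rw [← mem_branch, not_mem_branch hT hwr]
      exact hx
    have hxw : x ≠ w := by
      rintro rfl
      exact hxB (mem_branch.1 (self_mem_branch hwr))
    simp [branchPebbles, branchDemand, hxB, hxw]

/-- If the total surplus is negative, then there are too few pebbles to satisfy the demand even
when all of them are stacked on one suitable vertex. -/
theorem exists_stacking_of_rootSurplus_neg (hT : T.IsTree) (S : Finset V)
    (hS : ∀ a ∈ S, ∀ c ∈ S, ∀ x, T.dist a x + T.dist x c = T.dist a c → x ∈ S)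
    (ω D : V → ℕ) (hωS : ∀ x, ω x ≠ 0 → x ∈ S) (hD : SupportedInHull T ω D)
    (hneg : ∀ r, rootSurplus T (fun x => (D x : ℤ) - ω x) r < 0) :
    ∃ v ∈ S, ∑ x, (D x : ℤ) < ∑ x, (ω x : ℤ) * 2 ^ T.dist x v := by
  induction hn : S.card using Nat.strong_induction_on generalizing S ω D with
  | _ n ihn =>
  subst hn
  induction hm : ∑ r, (-rootSurplus T (fun x => (D x : ℤ) - ω x) r).toNat
    using Nat.strong_induction_on generalizing D with
  | _ m ihm =>
  subst hm
  by_cases hedge : ∀ u v, T.Adj u v → surplus T (fun x => (D x : ℤ) - ω x) u v < 0 →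
      0 ≤ surplus T (fun x => (D x : ℤ) - ω x) v u
  · obtain ⟨r, hr⟩ := exists_sink hT hedge
    have hωr : ω r ≠ 0 := by
      intro h0
      have h1 := hneg r
      have h2 : 0 ≤ ∑ w ∈ T.neighborFinset r,
          transfer (surplus T (fun x => (D x : ℤ) - ω x) w r) :=
        Finset.sum_nonneg fun w hw => transfer_nonneg (hr w (by simpa using hw))
      rw [rootSurplus, h0] at h1
      push_cast at h1
      linarith [Int.natCast_nonneg (D r)]
    have hrS := hωS r hωr
    refine exists_stacking_of_branches hT hrS (hneg r) hr fun w hw hDw => ?_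
    obtain ⟨c, hcB, hc⟩ := hD.exists_mem_branch hT hw.symm hDw
    refine ⟨⟨c, hcB, hc⟩, ?_⟩
    have hcr := dist_of_mem_branch hT hw.symm hcB
    have hwS : w ∈ S := hS c (hωS c hc) r hrS w (by
      rw [hcr, dist_eq_one_iff_adj.2 hw.symm])
    have hcard : (S ∩ branch T w r).card < S.card := by
      refine Finset.card_lt_card ⟨Finset.inter_subset_left, fun h => ?_⟩
      exact branch_ne hT hw.symm (Finset.mem_inter.1 (h hrS)).2 rfl
    have hwnn := hr w hw
    set k := (surplus T (fun x => (D x : ℤ) - ω x) w r).toNat with hk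
    obtain ⟨v, hv, hlt⟩ := ihn _ hcard (S ∩ branch T w r)
      (fun a ha c hc x hx => by
        rw [Finset.mem_inter] at ha hc ⊢
        exact ⟨hS a ha.1 c hc.1 x hx, branch_convex hT hw.symm ha.2 hc.2 hx⟩)
      (branchDemand T ω w r (k + 1)) (branchPebbles T D w r)
      (fun x hx => by
        rw [Finset.mem_inter]
        by_cases hxw : x = w
        · subst hxw
          exact ⟨hwS, self_mem_branch hw.symm⟩
        · have hxB : x ∈ branch T w r := by
            rw [mem_branch]
            by_contra hxB
            simp [branchDemand, hxw, hxB] at hx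
          have := mem_branch.1 hxB
          refine ⟨hωS x ?_, hxB⟩
          simpa [branchDemand, hxw, this] using hx)
      (hD.restrict_branch hT hw.symm k)
      (rootSurplus_neg hT (rootSurplus_branch_neg hT hw.symm hwnn)) rfl
    rw [Finset.mem_inter] at hv
    refine ⟨v, hv.1, hv.2, ?_⟩
    rw [sum_branchDemand, sum_branchPebbles] at hlt
    push_cast at hlt
    rwa [hk, Int.toNat_of_nonneg hwnn] at hlt
  · push Not at hedge
    obtain ⟨u, v, huv, hu, hv⟩ := hedge
    set D' : V → ℕ := D + Pi.single u 1 with hD'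
    have hDu : D' u = D u + 1 := by simp [hD']
    have hDne : ∀ x, x ≠ u → D' x = D x := fun x hx => by simp [hD', hx]
    have hle : ∀ x, (D x : ℤ) - ω x ≤ D' x - ω x := fun x => by simp [hD']
    have hroot : rootSurplus T (fun x => (D' x : ℤ) - ω x) u =
        rootSurplus T (fun x => (D x : ℤ) - ω x) u + 1 := by
      rw [rootSurplus, rootSurplus, hDu]
      have : ∑ w ∈ T.neighborFinset u, transfer (surplus T (fun x => (D' x : ℤ) - ω x) w u) =
          ∑ w ∈ T.neighborFinset u, transfer (surplus T (fun x => (D x : ℤ) - ω x) w u) := by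
        refine Finset.sum_congr rfl fun w hw => ?_
        rw [mem_neighborFinset] at hw
        congr 1
        refine surplus_congr hT hw.symm fun x hx => ?_
        rw [hDne x (branch_ne hT hw.symm hx)]
      rw [this]
      push_cast
      ring
    have hu3 : rootSurplus T (fun x => (D x : ℤ) - ω x) u ≤ -3 := by
      rw [rootSurplus_eq hT _ huv, transfer, if_neg (not_le.2 hv)]
      omega
    have hmono := rootSurplus_mono hT hle
    obtain ⟨z, hz, hlt⟩ := ihm _ (by
        refine Finset.sum_lt_sum (fun x _ => ?_) ⟨u, Finset.mem_univ u, ?_⟩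
        · have := hmono x
          omega
        · omega) D'
      (fun x hx => by
        by_cases hxu : x = u
        · subst hxu
          obtain ⟨a, ha, hωa⟩ := exists_demand_of_surplus_neg hT huv hu
          obtain ⟨c, hc, hωc⟩ := exists_demand_of_surplus_neg hT huv.symm hv
          refine ⟨a, c, hωa, hωc, ?_⟩
          rw [dist_across_branch hT huv ha hc,
            dist_across_branch hT huv (self_mem_branch huv) hc]
          simp; ring
        · rw [hDne x hxu] at hx
          exact hD x hx)
      (rootSurplus_neg hT (r := u) (by omega)) rfl
    refine ⟨z, hz, lt_of_le_of_lt (Finset.sum_le_sum fun x _ => ?_) hlt⟩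
    linarith [hle x]

end StackingTheorem

section CoverNumber

variable [Fintype V] {T : SimpleGraph V} [DecidableRel T.Adj]

lemma PebStep.sum_mul_pow_dist_le (hT : T.Connected) (v : V) {D D' : V → ℕ} (h : PebStep T D D') :
    ∑ x, D' x * 2 ^ T.dist x v ≤ ∑ x, D x * 2 ^ T.dist x v := by
  obtain ⟨a, b, hab, h2, rfl⟩ := h
  have hb : b ∈ univ.erase a := by simp [hab.ne']
  rw [← Finset.add_sum_erase _ _ (Finset.mem_univ a), ← Finset.add_sum_erase _ _ hb,
    ← Finset.add_sum_erase _ (fun x => D x * _) (Finset.mem_univ a),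
    ← Finset.add_sum_erase _ (fun x => D x * _) hb]
  have hrest : ∑ x ∈ (univ.erase a).erase b,
      (if x = a then D a - 2 else if x = b then D b + 1 else D x) * 2 ^ T.dist x v =
      ∑ x ∈ (univ.erase a).erase b, D x * 2 ^ T.dist x v := by
    refine Finset.sum_congr rfl fun x hx => ?_
    simp only [Finset.mem_erase] at hx
    rw [if_neg hx.2.1, if_neg hx.1]
  simp only [hrest, if_true, if_neg hab.ne']
  have hpow : 2 ^ T.dist b v ≤ 2 * 2 ^ T.dist a v := by
    rw [← pow_succ']
    refine pow_le_pow_right₀ (by norm_num) ?_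
    have := hT.dist_triangle (u := b) (v := a) (w := v)
    rw [dist_eq_one_iff_adj.2 hab.symm] at this
    omega
  obtain ⟨k, hk⟩ := Nat.exists_eq_add_of_le h2
  rw [hk, Nat.add_sub_cancel_left]
  nlinarith

lemma Solvable.sum_mul_pow_dist_le (hT : T.Connected) (v : V) {ω D : V → ℕ} (h : Solvable T ω D) :
    ∑ x, ω x * 2 ^ T.dist x v ≤ ∑ x, D x * 2 ^ T.dist x v := by
  obtain ⟨D', hreach, hle⟩ := h
  refine (Finset.sum_le_sum fun x _ => Nat.mul_le_mul_right _ (hle x)).trans ?_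
  clear hle
  induction hreach with
  | refl => exact le_rfl
  | tail _ hs ih => exact (hs.sum_mul_pow_dist_le hT v).trans ih

/-- In a tree, each branch contains a leaf. -/
lemma exists_leaf_mem_branch (hT : T.IsTree) {u v : V} (huv : T.Adj u v) :
    ∃ x ∈ branch T u v, T.degree x = 1 := by
  refine branch_induction hT (P := fun u v => ∃ x ∈ branch T u v, T.degree x = 1) ?_ huv
  intro u v huv ih
  by_cases h : ∃ w, T.Adj u w ∧ w ≠ v
  · obtain ⟨w, hw, hne⟩ := h
    obtain ⟨x, hx, hdeg⟩ := ih w hw hne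
    exact ⟨x, branch_subset hT huv hw hne hx, hdeg⟩
  · push Not at h
    refine ⟨u, self_mem_branch huv, ?_⟩
    rw [← card_neighborFinset_eq_degree, Finset.card_eq_one]
    refine ⟨v, Finset.eq_singleton_iff_unique_mem.2 ⟨by simpa using huv, fun w hw => ?_⟩⟩
    exact h w (by simpa using hw)

lemma supportedInHull_of_leaves (hT : T.IsTree) {ω : V → ℕ}
    (hL : ∀ v, T.degree v = 1 → 0 < ω v) (hω : ω ≠ 0) (D : V → ℕ) : SupportedInHull T ω D := by
  intro x _
  by_cases hx : ω x = 0
  · obtain ⟨y, hy⟩ := Function.ne_iff.1 hω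
    have hyx : y ≠ x := by rintro rfl; exact hy hx
    obtain ⟨w, hw, -⟩ := exists_branch hT hyx
    obtain ⟨z, hz, hzw⟩ : ∃ z, T.Adj x z ∧ z ≠ w := by
      by_contra! hc
      have : T.degree x = 1 := by
        rw [← card_neighborFinset_eq_degree, Finset.card_eq_one]
        exact ⟨w, Finset.eq_singleton_iff_unique_mem.2
          ⟨by simpa using hw, fun z hz => hc z (by simpa using hz)⟩⟩
      exact (hL x this).ne' hx
    obtain ⟨a, ha, hadeg⟩ := exists_leaf_mem_branch hT hw.symm
    obtain ⟨c, hc, hcdeg⟩ := exists_leaf_mem_branch hT hz.symm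
    refine ⟨a, c, (hL a hadeg).ne', (hL c hcdeg).ne', ?_⟩
    rw [dist_across_branch hT hw.symm ha (branch_subset hT hw hz hzw hc),
      dist_of_mem_branch hT hw.symm ha]
  · exact ⟨x, x, hx, hx, by simp⟩

end CoverNumber

/-- If every leaf of the tree `T` has positive weight, then
`γ_ω(T) = max_v Σ_u ω(u)·2^{d(u,v)}`. -/
theorem cover_pebbling_leaves_in_support (T : SimpleGraph V) [Fintype V]
    [DecidableRel T.Adj] (hT : T.IsTree) (ω : V → ℕ)
    (hL : ∀ v, T.degree v = 1 → 0 < ω v) :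
    coverNum T ω = Finset.univ.sup (fun v => ∑ u, ω u * 2 ^ T.dist u v) := by
  have hmem : ∀ D : V → ℕ, ∑ v, D v = univ.sup (fun v => ∑ u, ω u * 2 ^ T.dist u v) →
      Solvable T ω D := by
    intro D hD
    by_cases hω : ω = 0
    · exact solvable_of_le (by simp [hω])
    by_contra hns
    obtain ⟨v, -, hlt⟩ := exists_stacking_of_rootSurplus_neg hT univ
      (fun _ _ _ _ x _ => Finset.mem_univ x) ω D (fun x _ => Finset.mem_univ x)
      (supportedInHull_of_leaves hT hL hω D)
      (fun r => not_le.1 fun h => hns (solvable_of_rootSurplus_nonneg hT h))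
    have hle := Finset.le_sup (f := fun v => ∑ u, ω u * 2 ^ T.dist u v) (Finset.mem_univ v)
    rw [← hD] at hle
    exact absurd (by exact_mod_cast hlt) hle.not_gt
  refine le_antisymm (Nat.sInf_le hmem) (le_csInf ⟨_, hmem⟩ fun N hN => ?_)
  refine Finset.sup_le fun v _ => ?_
  have h := (hN (Pi.single v N) (by simp)).sum_mul_pow_dist_le hT.connected v
  simpa [Pi.single_apply] using h
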